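/- Fix an integer N ≥ 2 and a real ρ > 0, and let A be the N×N tridiagonal matrix defined below. Let D be the diagonal N×N matrix with diagonal entries D(n,n) = √((n+1)·w_n), where w_n = ((N−1)!/(N−n−1)!)·(ρ/N)^n. Then D is invertible and the matrix D·A·D⁻¹ is symmetric. -/

import Mathlib

/-- The `N × N` tridiagonal transition matrix of the finite population
processor-sharing queue: `A(n,n) = -1 - ρ(N-n-1)/N`, `A(n,n+1) = ρ(N-n-1)/N`,
`A(n,n-1) = n/(n+1)`, all other entries zero. -/
noncomputable def psMatrix (N : ℕ) (ρ : ℝ) : Matrix (Fin N) (Fin N) ℝ :=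
  Matrix.of fun n m =>
    if (m : ℕ) = (n : ℕ) then -1 - ρ * ((N : ℝ) - (n : ℕ) - 1) / N
    else if (m : ℕ) = (n : ℕ) + 1 then ρ * ((N : ℝ) - (n : ℕ) - 1) / N
    else if (m : ℕ) + 1 = (n : ℕ) then (n : ℝ) / ((n : ℝ) + 1)
    else 0

/-- The weights `w_n = ((N-1)!/(N-n-1)!) (ρ/N)^n`. -/
noncomputable def psWeight (N : ℕ) (ρ : ℝ) (n : ℕ) : ℝ :=
  (Nat.factorial (N - 1) : ℝ) / (Nat.factorial (N - 1 - n)) * (ρ / N) ^ n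

lemma psWeight_pos (N : ℕ) (hN : 2 ≤ N) (ρ : ℝ) (hρ : 0 < ρ) (n : ℕ) : 0 < psWeight N ρ n := by
  have hN' : (0 : ℝ) < N := by
    have : 0 < N := by omega
    exact_mod_cast this
  have h1 := Nat.factorial_pos (N - 1)
  have h2 := Nat.factorial_pos (N - 1 - n)
  unfold psWeight
  positivity

lemma psWeight_succ (N : ℕ) (ρ : ℝ) (n : ℕ) (hn : n + 1 < N) :
    psWeight N ρ (n + 1) = psWeight N ρ n * (ρ * ((N : ℝ) - n - 1) / N) := by
  obtain ⟨k, rfl⟩ : ∃ k, N = n + 2 + k := ⟨N - (n + 2), by omega⟩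
  unfold psWeight
  rw [show n + 2 + k - 1 - (n + 1) = k by omega, show n + 2 + k - 1 - n = k + 1 by omega,
    Nat.factorial_succ]
  have h2 : (Nat.factorial k : ℝ) ≠ 0 := by exact_mod_cast Nat.factorial_ne_zero k
  have h3 : (k : ℝ) + 1 ≠ 0 := by positivity
  have h4 : (n : ℝ) + 2 + k ≠ 0 := by positivity
  push_cast
  rw [show (n : ℝ) + 2 + k - n - 1 = k + 1 by ring, pow_succ]
  field_simp

lemma ps_balance_succ (N : ℕ) (ρ : ℝ) (i j : Fin N) (h : (j : ℕ) = i + 1) :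
    (((i : ℕ) + 1 : ℝ) * psWeight N ρ i) * psMatrix N ρ i j =
      (((j : ℕ) + 1 : ℝ) * psWeight N ρ j) * psMatrix N ρ j i := by
  have hj := j.2
  have e1 : psMatrix N ρ i j = ρ * ((N : ℝ) - (i : ℕ) - 1) / N := by
    simp [psMatrix, h]
  have e2 : psMatrix N ρ j i = ((j : ℕ) : ℝ) / (((j : ℕ) : ℝ) + 1) := by
    have a1 : ¬ (i : ℕ) = (j : ℕ) := by omega
    have a2 : ¬ (i : ℕ) = (j : ℕ) + 1 := by omega
    have a3 : (i : ℕ) + 1 = (j : ℕ) := by omega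
    simp only [psMatrix, Matrix.of_apply, if_neg a1, if_neg a2, if_pos a3]
  rw [e1, e2, h, psWeight_succ N ρ i (by omega)]
  have : ((i : ℕ) : ℝ) + 1 + 1 ≠ 0 := by positivity
  push_cast
  generalize ρ * ((N : ℝ) - ((i : ℕ) : ℝ) - 1) / N = c
  field_simp

lemma ps_balance (N : ℕ) (ρ : ℝ) (i j : Fin N) :
    (((i : ℕ) + 1 : ℝ) * psWeight N ρ i) * psMatrix N ρ i j =
      (((j : ℕ) + 1 : ℝ) * psWeight N ρ j) * psMatrix N ρ j i := by
  by_cases h0 : i = j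
  · rw [h0]
  by_cases h1 : (j : ℕ) = i + 1
  · exact ps_balance_succ N ρ i j h1
  by_cases h2 : (i : ℕ) = j + 1
  · exact (ps_balance_succ N ρ j i h2).symm
  have h0' : (i : ℕ) ≠ j := fun h => h0 (Fin.ext h)
  have e1 : psMatrix N ρ i j = 0 := by
    simp only [psMatrix, Matrix.of_apply]
    rw [if_neg (by omega), if_neg (by omega), if_neg (by omega)]
  have e2 : psMatrix N ρ j i = 0 := by
    simp only [psMatrix, Matrix.of_apply]
    rw [if_neg (by omega), if_neg (by omega), if_neg (by omega)]
  rw [e1, e2]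
  simp

/-- with `D` the diagonal matrix with entries `√((n+1) w_n)`,
`D` is invertible and `D A D⁻¹` is symmetric. -/
theorem ps_symmetrization (N : ℕ) (hN : 2 ≤ N) (ρ : ℝ) (hρ : 0 < ρ) :
    IsUnit (Matrix.diagonal fun n : Fin N =>
        Real.sqrt (((n : ℕ) + 1 : ℝ) * psWeight N ρ n)) ∧
      ((Matrix.diagonal fun n : Fin N =>
          Real.sqrt (((n : ℕ) + 1 : ℝ) * psWeight N ρ n)) * psMatrix N ρ *
        (Matrix.diagonal fun n : Fin N =>
          Real.sqrt (((n : ℕ) + 1 : ℝ) * psWeight N ρ n))⁻¹).IsSymm := by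
  have hpos : ∀ n : Fin N, 0 < ((n : ℕ) + 1 : ℝ) * psWeight N ρ n := fun n =>
    mul_pos (by positivity) (psWeight_pos N hN ρ hρ n)
  have hd : ∀ n : Fin N, Real.sqrt (((n : ℕ) + 1 : ℝ) * psWeight N ρ n) ≠ 0 := fun n =>
    (Real.sqrt_pos.2 (hpos n)).ne'
  generalize hD : (fun n : Fin N => Real.sqrt (((n : ℕ) + 1 : ℝ) * psWeight N ρ n)) = d
  have hd' : ∀ n, d n ≠ 0 := by subst hD; exact hd
  have hb : ∀ i j, d i * d i * psMatrix N ρ i j = d j * d j * psMatrix N ρ j i := by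
    subst hD
    intro i j
    have hi := Real.mul_self_sqrt (hpos i).le
    have hj := Real.mul_self_sqrt (hpos j).le
    simp only [hi, hj]
    exact ps_balance N ρ i j
  have hinv : (Matrix.diagonal d)⁻¹ = Matrix.diagonal fun n => (d n)⁻¹ := by
    apply Matrix.inv_eq_right_inv
    rw [Matrix.diagonal_mul_diagonal, ← Matrix.diagonal_one]
    congr 1
    funext n
    exact mul_inv_cancel₀ (hd' n)
  refine ⟨?_, ?_⟩
  · rw [Matrix.isUnit_diagonal, Pi.isUnit_iff]
    exact fun n => (hd' n).isUnit
  · rw [hinv]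
    ext i j
    simp only [Matrix.transpose_apply, Matrix.mul_diagonal, Matrix.diagonal_mul]
    have h1 := hd' i
    have h2 := hd' j
    have h3 := hb i j
    field_simp
    linarith
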